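/- For all n ≥ 3 and d ≥ 2, every row-sum and column-sum inequality of (subD) is facet-defining for the joint matching polytope C_{n,d}: for each 1 ≤ i < j ≤ n and each t ∈ [d], the inequality Σ_{q∈[d]} X_{tq}(i,j) ≤ 1 (and likewise each column-sum inequality Σ_{t∈[d]} X_{tq}(i,j) ≤ 1) is valid for C_{n,d} and the face on which it holds with equality has affine dimension (n choose 2)d² − 1. -/

import Mathlib

/-- Index set of ordered pairs `i < j`. -/
abbrev PairIdx (n : ℕ) := {p : Fin n × Fin n // p.1 < p.2}

/-- Coordinates of the vectorization of a collection of matrices `X(i,j)`, `i < j`. -/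
abbrev JIdx (n d : ℕ) := PairIdx n × (Fin d × Fin d)

/-- `x` is the vectorization of a collection of consistent partial maps: binary entries,
row and column sums at most one, and the triangle system (gtri). -/
def IsConsistentVec (n d : ℕ) (x : JIdx n d → ℝ) : Prop :=
  (∀ (e : PairIdx n) (t q : Fin d), x (e, (t, q)) = 0 ∨ x (e, (t, q)) = 1) ∧
  (∀ (e : PairIdx n) (t : Fin d), ∑ q : Fin d, x (e, (t, q)) ≤ 1) ∧
  (∀ (e : PairIdx n) (q : Fin d), ∑ t : Fin d, x (e, (t, q)) ≤ 1) ∧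
  (∀ (i j k : Fin n) (hij : i < j) (hjk : j < k) (l t q : Fin d),
      - x (⟨(i, j), hij⟩, (l, t)) + x (⟨(j, k), hjk⟩, (t, q))
          + x (⟨(i, k), lt_trans hij hjk⟩, (l, q)) ≤ 1 ∧
      x (⟨(i, j), hij⟩, (l, t)) - x (⟨(j, k), hjk⟩, (t, q))
          + x (⟨(i, k), lt_trans hij hjk⟩, (l, q)) ≤ 1 ∧
      x (⟨(i, j), hij⟩, (l, t)) + x (⟨(j, k), hjk⟩, (t, q))
          - x (⟨(i, k), lt_trans hij hjk⟩, (l, q)) ≤ 1)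

/-- The joint matching polytope `C_{n,d}`: the convex hull of the vectorizations of all
consistent partial maps. -/
def jointMatchingPolytope (n d : ℕ) : Set (JIdx n d → ℝ) :=
  convexHull ℝ {x | IsConsistentVec n d x}

/-- Indicator vector of the edge between vertices `v` and `w`. -/
noncomputable def Ed (n d : ℕ) (v w : Fin n × Fin d) : JIdx n d → ℝ := fun c =>
  if (((c.1.1.1, c.2.1) = v ∧ (c.1.1.2, c.2.2) = w) ∨
      ((c.1.1.1, c.2.1) = w ∧ (c.1.1.2, c.2.2) = v)) then 1 else 0

/-- Vector of a labelling. -/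
noncomputable def labVec (n d : ℕ) (f : Fin n × Fin d → Fin n × Fin d) : JIdx n d → ℝ := fun c =>
  if f (c.1.1.1, c.2.1) = f (c.1.1.2, c.2.2) then 1 else 0

theorem labVec_consistent (n d : ℕ) (f : Fin n × Fin d → Fin n × Fin d)
    (hf : ∀ i a b, f (i, a) = f (i, b) → a = b) : IsConsistentVec n d (labVec n d f) := by
  refine ⟨?_, ?_, ?_, ?_⟩
  · intro e t q
    unfold labVec
    split_ifs <;> simp
  · intro e t
    simp only [labVec]
    rw [Finset.sum_boole]
    have : (Finset.univ.filter fun q : Fin d => f (e.1.1, t) = f (e.1.2, q)).card ≤ 1 := by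
      rw [Finset.card_le_one]
      intro a ha b hb
      simp only [Finset.mem_filter, Finset.mem_univ, true_and] at ha hb
      exact hf _ _ _ (ha.symm.trans hb)
    exact_mod_cast this
  · intro e q
    simp only [labVec]
    rw [Finset.sum_boole]
    have : (Finset.univ.filter fun t : Fin d => f (e.1.1, t) = f (e.1.2, q)).card ≤ 1 := by
      rw [Finset.card_le_one]
      intro a ha b hb
      simp only [Finset.mem_filter, Finset.mem_univ, true_and] at ha hb
      exact hf _ _ _ (ha.trans hb.symm)
    exact_mod_cast this
  · intro i j k hij hjk l t q
    simp only [labVec]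
    by_cases h1 : f (i, l) = f (j, t) <;> by_cases h2 : f (j, t) = f (k, q) <;>
      by_cases h3 : f (i, l) = f (k, q) <;> simp_all

theorem Ed_comm (n d : ℕ) (v w : Fin n × Fin d) : Ed n d v w = Ed n d w v := by
  funext c
  simp only [Ed]
  congr 1
  rw [or_comm]

theorem Ed_single (n d : ℕ) (c : JIdx n d) :
    (Pi.single c 1 : JIdx n d → ℝ) = Ed n d (c.1.1.1, c.2.1) (c.1.1.2, c.2.2) := by
  funext c'
  obtain ⟨⟨⟨a, b⟩, h⟩, s, t⟩ := c
  obtain ⟨⟨⟨a', b'⟩, h'⟩, s', t'⟩ := c'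
  simp only [Ed, Pi.single_apply, Prod.mk.injEq, Subtype.mk.injEq]
  simp only at h h'
  congr 1
  apply propext
  constructor
  · grind
  · rintro (h1 | h1)
    · grind
    · exfalso; obtain ⟨⟨rfl, _⟩, rfl, _⟩ := h1
      exact lt_asymm h h'

theorem cons_one (n d : ℕ) (v w : Fin n × Fin d) (h : v.1 ≠ w.1) :
    IsConsistentVec n d (Ed n d v w) := by
  have : Ed n d v w = labVec n d (fun p => if p = w then v else p) := by
    funext ⟨⟨⟨a, b⟩, h'⟩, s, t⟩
    simp only [Ed, labVec]
    have hab : a ≠ b := ne_of_lt h'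
    congr 1
    grind
  rw [this]
  apply labVec_consistent
  grind

theorem cons_two (n d : ℕ) (v w a b : Fin n × Fin d) (h : v.1 ≠ w.1) (h' : a.1 ≠ b.1)
    (h1 : a ≠ v) (h2 : a ≠ w) (h3 : b ≠ v) (h4 : b ≠ w) :
    IsConsistentVec n d (Ed n d v w + Ed n d a b) := by
  have : Ed n d v w + Ed n d a b =
      labVec n d (fun p => if p = w then v else if p = b then a else p) := by
    funext ⟨⟨⟨x, y⟩, h'⟩, s, t⟩
    simp only [Ed, labVec, Pi.add_apply]
    have hab : x ≠ y := ne_of_lt h'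
    grind
  rw [this]
  apply labVec_consistent
  grind

theorem cons_three (n d : ℕ) (v w b : Fin n × Fin d) (h : v.1 ≠ w.1) (h' : v.1 ≠ b.1)
    (h1 : w.1 ≠ b.1) :
    IsConsistentVec n d (Ed n d v w + Ed n d v b + Ed n d w b) := by
  have : Ed n d v w + Ed n d v b + Ed n d w b =
      labVec n d (fun p => if p = w then v else if p = b then v else p) := by
    funext ⟨⟨⟨x, y⟩, h'⟩, s, t⟩
    simp only [Ed, labVec, Pi.add_apply]
    have hab : x ≠ y := ne_of_lt h'
    grind
  rw [this]
  apply labVec_consistent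
  grind

theorem card_PairIdx (n : ℕ) : Fintype.card (PairIdx n) = n.choose 2 := by
  rw [Fintype.card_subtype, Finset.card_filter, Fintype.sum_prod_type_right]
  have : ∀ y : Fin n, (∑ x : Fin n, if x < y then 1 else 0) = (y : ℕ) := by
    intro y
    rw [← Finset.card_filter, Finset.filter_gt_eq_Iio, Fin.card_Iio]
  simp only [this]
  rw [Fin.sum_univ_eq_sum_range (fun i => i), Finset.sum_range_id, Nat.choose_two_right]

theorem face_dim (n d : ℕ) (hd : 2 ≤ d) (v : Fin n × Fin d) (j : Fin n) (hj : v.1 ≠ j)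
    (φ : (JIdx n d → ℝ) →ₗ[ℝ] ℝ)
    (h1 : ∀ q, φ (Ed n d v (j, q)) = 1)
    (h0 : ∀ a b, a.1 ≠ b.1 → a ≠ v → b ≠ v → φ (Ed n d a b) = 0)
    (h0' : ∀ b, b.1 ≠ v.1 → b.1 ≠ j → φ (Ed n d v b) = 0) :
    Module.finrank ℝ (vectorSpan ℝ {x ∈ jointMatchingPolytope n d | φ x = 1}) =
      n.choose 2 * d ^ 2 - 1 := by
  set W := vectorSpan ℝ {x ∈ jointMatchingPolytope n d | φ x = 1} with hW
  have sub : ∀ x y, IsConsistentVec n d x → IsConsistentVec n d y → φ x = 1 → φ y = 1 →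
      x - y ∈ W := by
    intro x y hx hy hx1 hy1
    exact vsub_mem_vectorSpan ℝ ⟨subset_convexHull ℝ _ hx, hx1⟩ ⟨subset_convexHull ℝ _ hy, hy1⟩
  have hne : ∀ q : Fin d, ∃ q' : Fin d, q' ≠ q := by
    intro q
    have : Nontrivial (Fin d) := Fin.nontrivial_iff_two_le.mpr hd
    exact exists_ne q
  have A : ∀ a b, a.1 ≠ b.1 → a ≠ v → b ≠ v → Ed n d a b ∈ W := by
    intro a b hab ha hb
    obtain ⟨q, hqa, hqb⟩ : ∃ q, a ≠ (j, q) ∧ b ≠ (j, q) := by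
      by_cases haj : a.1 = j
      · obtain ⟨q, hq⟩ := hne a.2
        exact ⟨q, by grind, by grind⟩
      · obtain ⟨q, hq⟩ := hne b.2
        exact ⟨q, by grind, by grind⟩
    have := sub (Ed n d v (j, q) + Ed n d a b) (Ed n d v (j, q))
      (cons_two n d v (j, q) a b hj hab ha hqa hb hqb) (cons_one n d v (j, q) hj)
      (by rw [map_add, h1, h0 a b hab ha hb, add_zero]) (h1 q)
    simpa using this
  have B : ∀ b, b.1 ≠ v.1 → b.1 ≠ j → Ed n d v b ∈ W := by
    intro b hb hbj
    obtain ⟨q, -⟩ := hne b.2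
    have hA := A (j, q) b (Ne.symm hbj) (by grind) (by grind)
    have := sub (Ed n d v (j, q) + Ed n d v b + Ed n d (j, q) b) (Ed n d v (j, q))
      (cons_three n d v (j, q) b hj (Ne.symm hb) (Ne.symm hbj)) (cons_one n d v (j, q) hj)
      (by rw [map_add, map_add, h1, h0' b hb hbj,
            h0 (j, q) b (Ne.symm hbj) (by grind) (by grind)]; norm_num) (h1 q)
    have h3 := W.sub_mem this hA
    convert h3 using 1
    abel
  let q0 : Fin d := v.2
  have C : ∀ a b, a.1 ≠ b.1 → Ed n d a b - φ (Ed n d a b) • Ed n d v (j, q0) ∈ W := by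
    have C1 : ∀ b, b.1 ≠ v.1 → Ed n d v b - φ (Ed n d v b) • Ed n d v (j, q0) ∈ W := by
      intro b hb
      by_cases hbj : b.1 = j
      · obtain ⟨b1, b2⟩ := b
        simp only at hbj
        subst hbj
        rw [h1, one_smul]
        exact sub _ _ (cons_one n d _ _ hj) (cons_one n d _ _ hj) (h1 _) (h1 _)
      · rw [h0' b hb hbj, zero_smul, sub_zero]
        exact B b hb hbj
    intro a b hab
    by_cases ha : a = v
    · subst ha
      exact C1 b (Ne.symm hab)
    · by_cases hb : b = v
      · subst hb
        rw [Ed_comm]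
        exact C1 a hab
      · rw [h0 a b hab ha hb, zero_smul, sub_zero]
        exact A a b hab ha hb
  have hker : W = LinearMap.ker φ := by
    apply le_antisymm
    · rw [hW, vectorSpan, Submodule.span_le]
      rintro _ ⟨x, hx, y, hy, rfl⟩
      simp [hx.2, hy.2]
    · intro x hx
      have hx0 : φ x = 0 := hx
      have key : ∀ x : JIdx n d → ℝ, x - φ x • Ed n d v (j, q0) ∈ W := by
        intro x
        have hx : x = ∑ c, x c • (Pi.single c 1 : JIdx n d → ℝ) := by
          funext c'
          simp [Finset.sum_apply, Pi.single_apply]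
        rw [hx, map_sum, Finset.sum_smul, ← Finset.sum_sub_distrib]
        refine W.sum_mem fun c _ => ?_
        rw [map_smul, smul_assoc, ← smul_sub, Ed_single]
        exact W.smul_mem _ (C _ _ (ne_of_lt c.1.2))
      simpa [hx0] using key x
  rw [hker]
  have hr := LinearMap.finrank_range_add_finrank_ker φ
  have hs : LinearMap.range φ = ⊤ := by
    rw [LinearMap.range_eq_top]
    intro r
    exact ⟨r • Ed n d v (j, q0), by simp [h1]⟩
  rw [hs, finrank_top, Module.finrank_self, Module.finrank_fintype_fun_eq_card,
    Fintype.card_prod, card_PairIdx, Fintype.card_prod, Fintype.card_fin, ← pow_two] at hr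
  omega

theorem face_valid (n d : ℕ) (φ : (JIdx n d → ℝ) →ₗ[ℝ] ℝ)
    (h : ∀ x, IsConsistentVec n d x → φ x ≤ 1) :
    ∀ x ∈ jointMatchingPolytope n d, φ x ≤ 1 := by
  intro x hx
  exact convexHull_min (t := {x | φ x ≤ 1}) h (convex_halfSpace_le φ.isLinear 1) hx

/-- Every row-sum inequality and every column-sum inequality of (subD) is facet-defining
for the joint matching polytope: each is valid, and the corresponding face has affine
dimension `(n choose 2) * d ^ 2 - 1`. -/
theorem subD_inequalities_facet_defining (n d : ℕ) (hn : 3 ≤ n) (hd : 2 ≤ d)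
    (e : PairIdx n) (t : Fin d) :
    ((∀ x ∈ jointMatchingPolytope n d, ∑ q : Fin d, x (e, (t, q)) ≤ 1) ∧
      Module.finrank ℝ
          ↥(vectorSpan ℝ {x ∈ jointMatchingPolytope n d | ∑ q : Fin d, x (e, (t, q)) = 1}) =
        n.choose 2 * d ^ 2 - 1) ∧
    ((∀ x ∈ jointMatchingPolytope n d, ∑ s : Fin d, x (e, (s, t)) ≤ 1) ∧
      Module.finrank ℝ
          ↥(vectorSpan ℝ {x ∈ jointMatchingPolytope n d | ∑ s : Fin d, x (e, (s, t)) = 1}) =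
        n.choose 2 * d ^ 2 - 1) := by
  obtain ⟨⟨i, j⟩, hij⟩ := e
  simp only at hij
  have hne : i ≠ j := ne_of_lt hij
  have hlt : ¬ j < i := lt_asymm hij
  let φ : (JIdx n d → ℝ) →ₗ[ℝ] ℝ := ∑ q : Fin d, LinearMap.proj (⟨(i, j), hij⟩, (t, q))
  have hφ : ∀ x, φ x = ∑ q : Fin d, x (⟨(i, j), hij⟩, (t, q)) := by
    intro x; simp [φ]
  let ψ : (JIdx n d → ℝ) →ₗ[ℝ] ℝ := ∑ s : Fin d, LinearMap.proj (⟨(i, j), hij⟩, (s, t))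
  have hψ : ∀ x, ψ x = ∑ s : Fin d, x (⟨(i, j), hij⟩, (s, t)) := by
    intro x; simp [ψ]
  have e1 : {x ∈ jointMatchingPolytope n d | ∑ q : Fin d, x (⟨(i, j), hij⟩, (t, q)) = 1} =
      {x ∈ jointMatchingPolytope n d | φ x = 1} := by simp only [hφ]
  have e2 : {x ∈ jointMatchingPolytope n d | ∑ s : Fin d, x (⟨(i, j), hij⟩, (s, t)) = 1} =
      {x ∈ jointMatchingPolytope n d | ψ x = 1} := by simp only [hψ]
  rw [e1, e2]
  simp only [← hφ, ← hψ]
  refine ⟨⟨face_valid n d φ ?_, face_dim n d hd (i, t) j hne φ ?_ ?_ ?_⟩,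
    ⟨face_valid n d ψ ?_, face_dim n d hd (j, t) i hne.symm ψ ?_ ?_ ?_⟩⟩
  · intro x hx
    rw [hφ]; exact hx.2.1 _ _
  · intro q
    rw [hφ, Finset.sum_eq_single q]
    · simp [Ed]
    · intro q' _ h
      simp only [Ed]
      grind
    · simp
  · intro a b hab ha hb
    rw [hφ]
    apply Finset.sum_eq_zero
    intro q _
    simp only [Ed]
    grind
  · intro b hb hbj
    rw [hφ]
    apply Finset.sum_eq_zero
    intro q _
    simp only [Ed]
    grind
  · intro x hx
    rw [hψ]; exact hx.2.2.1 _ _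
  · intro q
    rw [hψ, Finset.sum_eq_single q]
    · simp [Ed]
    · intro q' _ h
      simp only [Ed]
      grind
    · simp
  · intro a b hab ha hb
    rw [hψ]
    apply Finset.sum_eq_zero
    intro q _
    simp only [Ed]
    grind
  · intro b hb hbj
    rw [hψ]
    apply Finset.sum_eq_zero
    intro q _
    simp only [Ed]
    grind
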